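/- arXiv:1803.01040 — 5 statements merged into one kernel-verified Lean document; each statement's English description precedes it below -/
import Mathlib

section
/- Let n, k ≥ 1 and let W, X be finite-dimensional real inner product spaces. Let A(ξ) = Σ_{|α|=k} ξ^α A_α (with A_α ∈ Lin(W,X), sum over multi-indices α of length n with |α| = k) be the symbol of a k-homogeneous linear constant-coefficient differential operator on ℝ^n. Then A has constant rank (i.e., rank A(ξ) is the same for all ξ ∈ ℝ^n \ {0}) if and only if there exist l ∈ ℕ, a finite-dimensional real inner product space V, and linear maps B_β ∈ Lin(V,W) indexed by multi-indices β with |β| = l, such that the l-homogeneous symbol B(ξ) = Σ_{|β|=l} ξ^β B_β satisfies ker A(ξ) = im B(ξ) for all ξ ∈ ℝ^n \ {0}. -/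
open scoped BigOperators

/-- The symbol of a homogeneous constant-coefficient linear differential operator:
`A(ξ) = ∑_{|α| = k} ξ^α A_α`, where the sum runs over multi-indices `α : Fin n → ℕ`
with `∑ i, α i = k`. -/
noncomputable def symbolOf {n : ℕ} {W X : Type*} [AddCommGroup W] [Module ℝ W]
    [AddCommGroup X] [Module ℝ X]
    (k : ℕ) (coef : (Fin n → ℕ) → (W →ₗ[ℝ] X)) (ξ : Fin n → ℝ) : W →ₗ[ℝ] X :=
  ∑ α ∈ Finset.Nat.antidiagonalTuple n k, (∏ i, ξ i ^ α i) • coef α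

section Symbol

variable {n : ℕ} {W X : Type*} [AddCommGroup W] [Module ℝ W] [AddCommGroup X] [Module ℝ X]

/-- Every linear functional of a symbol is a homogeneous polynomial in the frequency variable. -/
theorem exists_isHomogeneous_eval_eq_symbolOf (k : ℕ) (coef : (Fin n → ℕ) → (W →ₗ[ℝ] X))
    (φ : (W →ₗ[ℝ] X) →ₗ[ℝ] ℝ) :
    ∃ p : MvPolynomial (Fin n) ℝ, p.IsHomogeneous k ∧
      ∀ ξ, MvPolynomial.eval ξ p = φ (symbolOf k coef ξ) := by
  refine ⟨∑ α ∈ Finset.Nat.antidiagonalTuple n k,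
    MvPolynomial.C (φ (coef α)) * ∏ i, MvPolynomial.X i ^ α i, ?_, fun ξ => ?_⟩
  · refine MvPolynomial.IsHomogeneous.sum _ _ _ fun α hα => ?_
    rw [Finset.Nat.mem_antidiagonalTuple] at hα
    rw [← hα]
    exact (MvPolynomial.IsHomogeneous.prod _ _ _ fun i _ =>
      MvPolynomial.isHomogeneous_X_pow i (α i)).C_mul _
  · simp [symbolOf, map_sum, mul_comm]

/-- A matrix of homogeneous polynomials of degree `l`, composed with a linear map from matrices
to linear maps, is a homogeneous symbol of degree `l`. -/
theorem exists_symbolOf_eq_map_eval {ι κ : Type*} (l : ℕ)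
    (P : Matrix ι κ (MvPolynomial (Fin n) ℝ)) (hP : ∀ i j, (P i j).IsHomogeneous l)
    (Φ : Matrix ι κ ℝ →ₗ[ℝ] (W →ₗ[ℝ] X)) :
    ∃ coef : (Fin n → ℕ) → (W →ₗ[ℝ] X),
      ∀ ξ, symbolOf l coef ξ = Φ (P.map (MvPolynomial.eval ξ)) := by
  refine ⟨fun α => Φ (P.map fun p => p.coeff (Finsupp.equivFunOnFinite.symm α)), fun ξ => ?_⟩
  simp only [symbolOf, ← map_smul, ← map_sum]
  congr 1
  ext i j
  rw [Matrix.sum_apply, Matrix.map_apply, MvPolynomial.eval_eq']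
  simp only [Matrix.smul_apply, Matrix.map_apply, smul_eq_mul]
  trans ∑ d ∈ (Finset.Nat.antidiagonalTuple n l).map Finsupp.equivFunOnFinite.symm.toEmbedding,
    (P i j).coeff d * ∏ i, ξ i ^ d i
  · rw [Finset.sum_map]
    exact Finset.sum_congr rfl fun _ _ => mul_comm _ _
  symm
  refine Finset.sum_subset (fun d hd => ?_) fun d _ hd => ?_
  · rw [Finset.mem_map_equiv, Finset.Nat.mem_antidiagonalTuple]
    have h : Finsupp.weight (fun _ => 1) d = l := hP i j (MvPolynomial.mem_support_iff.mp hd)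
    rw [← Finsupp.degree_eq_weight_one, Finsupp.degree_eq_sum] at h
    exact h
  · rw [MvPolynomial.notMem_support_iff.mp hd, zero_mul]

end Symbol

section LowerSemicontinuity

variable {W X : Type*} [AddCommGroup W] [Module ℝ W] [FiniteDimensional ℝ W]
  [AddCommGroup X] [Module ℝ X]

/-- A linear map of rank `a` restricts and corestricts to the identity of `ℝ^a`. -/
theorem exists_comp_comp_eq_id (f : W →ₗ[ℝ] X) :
    ∃ (P : (Fin (Module.finrank ℝ (LinearMap.range f)) → ℝ) →ₗ[ℝ] W)
      (Q : X →ₗ[ℝ] (Fin (Module.finrank ℝ (LinearMap.range f)) → ℝ)),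
      Q ∘ₗ f ∘ₗ P = LinearMap.id := by
  obtain ⟨s, hs⟩ := f.rangeRestrict.exists_rightInverse_of_surjective f.range_rangeRestrict
  obtain ⟨π, hπ⟩ := (LinearMap.range f).subtype.exists_leftInverse_of_injective
    (Submodule.ker_subtype _)
  let e := (Module.finBasis ℝ (LinearMap.range f)).equivFun
  refine ⟨s ∘ₗ e.symm.toLinearMap, e.toLinearMap ∘ₗ π, ?_⟩
  refine LinearMap.ext fun x => ?_
  have h1 : f (s (e.symm x)) = (e.symm x : X) := congrArg Subtype.val (LinearMap.congr_fun hs _)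
  have h2 : π (e.symm x : X) = e.symm x := LinearMap.congr_fun hπ _
  simp only [LinearMap.comp_apply, LinearEquiv.coe_coe, h1, h2, LinearEquiv.apply_symm_apply,
    LinearMap.id_apply]

/-- A polynomial certificate for lower semicontinuity of the rank of a symbol. -/
theorem exists_mvPolynomial_finrank_range_le {n : ℕ} (k : ℕ)
    (coef : (Fin n → ℕ) → (W →ₗ[ℝ] X)) (ξ₀ : Fin n → ℝ) :
    ∃ p : MvPolynomial (Fin n) ℝ, p ≠ 0 ∧ ∀ ξ, MvPolynomial.eval ξ p ≠ 0 →
      Module.finrank ℝ (LinearMap.range (symbolOf k coef ξ₀)) ≤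
        Module.finrank ℝ (LinearMap.range (symbolOf k coef ξ)) := by
  obtain ⟨P, Q, hPQ⟩ := exists_comp_comp_eq_id (symbolOf k coef ξ₀)
  generalize Module.finrank ℝ (LinearMap.range (symbolOf k coef ξ₀)) = a at P Q hPQ ⊢
  have h (i j : Fin a) := exists_isHomogeneous_eval_eq_symbolOf k coef
    (LinearMap.proj i ∘ₗ Q ∘ₗ LinearMap.applyₗ (P (Pi.single j 1)))
  choose p _ hp using h
  have hdet (ξ : Fin n → ℝ) : MvPolynomial.eval ξ (Matrix.of p).det =
      LinearMap.det (Q ∘ₗ symbolOf k coef ξ ∘ₗ P) := by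
    rw [RingHom.map_det, ← LinearMap.det_toMatrix']
    congr 1
    ext i j
    simp [hp, LinearMap.toMatrix'_apply]
  refine ⟨(Matrix.of p).det, fun h0 => ?_, fun ξ hξ => ?_⟩
  · have := hdet ξ₀
    rw [hPQ, h0] at this
    simp at this
  · rw [hdet] at hξ
    have hr : LinearMap.range (Q ∘ₗ symbolOf k coef ξ ∘ₗ P) = ⊤ :=
      LinearMap.range_eq_top.mpr ((LinearMap.equivOfDetNeZero _ hξ).surjective)
    calc a = Module.finrank ℝ (LinearMap.range (Q ∘ₗ symbolOf k coef ξ ∘ₗ P)) := by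
          rw [hr, finrank_top, Module.finrank_fin_fun]
      _ ≤ Module.finrank ℝ (LinearMap.range (symbolOf k coef ξ ∘ₗ P)) := by
          rw [LinearMap.range_comp]
          exact Submodule.finrank_map_le _ _
      _ ≤ _ := Submodule.finrank_mono (LinearMap.range_comp_le_range _ _)

/-- An exact pair of symbols has constant rank. -/
theorem finrank_range_symbolOf_le_of_exact {n k l : ℕ} (hn : 1 ≤ n)
    {V : Type*} [AddCommGroup V] [Module ℝ V] [FiniteDimensional ℝ V]
    (Acoef : (Fin n → ℕ) → (W →ₗ[ℝ] X)) (Bcoef : (Fin n → ℕ) → (V →ₗ[ℝ] W))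
    (h : ∀ ξ : Fin n → ℝ, ξ ≠ 0 →
      LinearMap.ker (symbolOf k Acoef ξ) = LinearMap.range (symbolOf l Bcoef ξ))
    (ξ η : Fin n → ℝ) (hη : η ≠ 0) :
    Module.finrank ℝ (LinearMap.range (symbolOf k Acoef ξ)) ≤
      Module.finrank ℝ (LinearMap.range (symbolOf k Acoef η)) := by
  obtain ⟨p, hp0, hp⟩ := exists_mvPolynomial_finrank_range_le k Acoef ξ
  obtain ⟨q, hq0, hq⟩ := exists_mvPolynomial_finrank_range_le l Bcoef η
  have hne : p * q * MvPolynomial.X ⟨0, hn⟩ ≠ 0 :=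
    mul_ne_zero (mul_ne_zero hp0 hq0) (MvPolynomial.X_ne_zero _)
  obtain ⟨ζ, hζ⟩ : ∃ ζ, MvPolynomial.eval ζ (p * q * MvPolynomial.X ⟨0, hn⟩) ≠ 0 := by
    by_contra! h0
    exact hne (MvPolynomial.funext fun x => by rw [h0, map_zero])
  simp only [map_mul, MvPolynomial.eval_X, mul_ne_zero_iff] at hζ
  obtain ⟨⟨hpζ, hqζ⟩, hζ0⟩ := hζ
  have hζ' : ζ ≠ 0 := fun h0 => hζ0 (by simp [h0])
  have h1 := LinearMap.finrank_range_add_finrank_ker (symbolOf k Acoef ζ)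
  have h2 := LinearMap.finrank_range_add_finrank_ker (symbolOf k Acoef η)
  rw [h ζ hζ'] at h1
  rw [h η hη] at h2
  have h3 := hp ζ hpζ
  have h4 := hq ζ hqζ
  omega

end LowerSemicontinuity

section KernelPolynomial

variable {ι : Type*} [Fintype ι] [DecidableEq ι]

/-- The matrix `q(M)`, where `q` consists of the top `r + 1` coefficients of the characteristic
polynomial of `M`. If `M` is a real symmetric matrix of rank `r`, its range is the kernel
of `M`. -/
noncomputable def Matrix.kernelPolynomial {R : Type*} [CommRing R] (r : ℕ) (M : Matrix ι ι R) :
    Matrix ι ι R :=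
  ∑ m ∈ Finset.range (r + 1), M.charpoly.coeff (Fintype.card ι - r + m) • M ^ m

theorem Matrix.kernelPolynomial_map {R S : Type*} [CommRing R] [CommRing S] (f : R →+* S) (r : ℕ)
    (M : Matrix ι ι R) : (M.kernelPolynomial r).map f = (M.map f).kernelPolynomial r := by
  have h (N : Matrix ι ι R) : N.map f = f.mapMatrix N := rfl
  have hs (c : R) (N : Matrix ι ι R) : f.mapMatrix (c • N) = f c • f.mapMatrix N := by
    ext i j
    simp
  simp only [kernelPolynomial, h, map_sum, hs, map_pow]
  simp only [← h, Matrix.charpoly_map, Polynomial.coeff_map]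

theorem Matrix.isHomogeneous_pow_apply {σ : Type*} {e : ℕ}
    {M : Matrix ι ι (MvPolynomial σ ℝ)} (hM : ∀ i j, (M i j).IsHomogeneous e) (m : ℕ) (i j : ι) :
    ((M ^ m) i j).IsHomogeneous (e * m) := by
  induction m generalizing i j with
  | zero =>
    rw [pow_zero, mul_zero, Matrix.one_apply]
    split_ifs
    · exact MvPolynomial.isHomogeneous_one _ _
    · exact MvPolynomial.isHomogeneous_zero _ _ _
  | succ m ih =>
    rw [pow_succ, Matrix.mul_apply, Nat.mul_succ]
    exact MvPolynomial.IsHomogeneous.sum _ _ _ fun c _ => (ih i c).mul (hM c j)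

theorem Matrix.isHomogeneous_charpoly_coeff {σ : Type*} {e : ℕ}
    {M : Matrix ι ι (MvPolynomial σ ℝ)} (hM : ∀ i j, (M i j).IsHomogeneous e) {a b : ℕ}
    (hab : a + b = Fintype.card ι) : (M.charpoly.coeff a).IsHomogeneous (e * b) := by
  have h := Matrix.charpoly.univ_coeff_eval₂Hom ι (MvPolynomial.C (R := ℝ) (σ := σ))
    (fun x => M x.1 x.2) a
  rw [show Matrix.of (Function.curry fun x : ι × ι => M x.1 x.2) = M from rfl] at h
  rw [← h]
  exact (Matrix.charpoly.univ_coeff_isHomogeneous ℝ ι a b hab).eval₂ _ _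
    (fun _ => MvPolynomial.isHomogeneous_C _ _) fun x => hM x.1 x.2

theorem Matrix.isHomogeneous_kernelPolynomial {σ : Type*} {e r : ℕ}
    {M : Matrix ι ι (MvPolynomial σ ℝ)} (hM : ∀ i j, (M i j).IsHomogeneous e)
    (hr : r ≤ Fintype.card ι) (i j : ι) :
    (M.kernelPolynomial r i j).IsHomogeneous (e * r) := by
  rw [kernelPolynomial, Matrix.sum_apply]
  refine MvPolynomial.IsHomogeneous.sum _ _ _ fun m hm => ?_
  have hm' : m ≤ r := Nat.lt_succ_iff.mp (Finset.mem_range.mp hm)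
  rw [Matrix.smul_apply, smul_eq_mul, show e * r = e * (r - m) + e * m by
    rw [← mul_add, Nat.sub_add_cancel hm']]
  exact (Matrix.isHomogeneous_charpoly_coeff hM (by omega)).mul
    (Matrix.isHomogeneous_pow_apply hM m i j)

theorem Matrix.IsHermitian.charpoly_eq_X_pow_mul {S : Matrix ι ι ℝ} (hS : S.IsHermitian) :
    ∃ q : Polynomial ℝ, q.coeff 0 ≠ 0 ∧ q.natDegree = S.rank ∧
      S.charpoly = Polynomial.X ^ (Fintype.card ι - S.rank) * q := by
  have hcard := Finset.card_filter_add_card_filter_not (s := (Finset.univ : Finset ι))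
    (fun i => hS.eigenvalues i ≠ 0)
  have hrank : S.rank = (Finset.univ.filter fun i => hS.eigenvalues i ≠ 0).card := by
    rw [hS.rank_eq_card_non_zero_eigs, Fintype.card_subtype]
  refine ⟨∏ i ∈ Finset.univ.filter fun i => hS.eigenvalues i ≠ 0,
    (Polynomial.X - Polynomial.C (hS.eigenvalues i)), ?_, ?_, ?_⟩
  · rw [Polynomial.coeff_zero_eq_eval_zero, Polynomial.eval_prod, Finset.prod_ne_zero_iff]
    intro i hi
    simpa using (Finset.mem_filter.mp hi).2
  · rw [Polynomial.natDegree_prod_of_monic _ _ fun i _ => Polynomial.monic_X_sub_C _]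
    simp [hrank]
  · rw [hS.charpoly_eq, ← Finset.prod_filter_mul_prod_filter_not Finset.univ
      (fun i => hS.eigenvalues i ≠ 0), mul_comm]
    congr 1
    rw [Finset.prod_congr rfl (g := fun _ => Polynomial.X), Finset.prod_const]
    · congr 1
      rw [Finset.card_univ] at hcard
      omega
    · intro i hi
      have : hS.eigenvalues i = 0 := by simpa using hi
      simp [this]

theorem Matrix.kernelPolynomial_eq_aeval {S : Matrix ι ι ℝ} {q : Polynomial ℝ}
    (hdeg : q.natDegree = S.rank)
    (hq : S.charpoly = Polynomial.X ^ (Fintype.card ι - S.rank) * q) :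
    S.kernelPolynomial S.rank = Polynomial.aeval S q := by
  rw [Polynomial.aeval_eq_sum_range, hdeg, kernelPolynomial, hq]
  refine Finset.sum_congr rfl fun m _ => ?_
  rw [add_comm, Polynomial.coeff_X_pow_mul]

theorem Matrix.IsHermitian.mul_eq_zero_of_pow_mul_eq_zero {S N : Matrix ι ι ℝ}
    (hS : S.IsHermitian) (m : ℕ) (h : S ^ m * N = 0) : S * N = 0 := by
  induction m with
  | zero => rw [pow_zero, one_mul] at h; rw [h, mul_zero]
  | succ m ih =>
    cases m with
    | zero => simpa using h
    | succ m =>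
      refine ih ?_
      rw [pow_succ', Matrix.mul_assoc] at h ⊢
      rw [pow_succ', Matrix.mul_assoc, ← Matrix.mul_assoc S S] at h
      nth_rewrite 1 [← hS.eq] at h
      exact (Matrix.conjTranspose_mul_self_mul_eq_zero S _).mp h

theorem Matrix.IsHermitian.mulVec_eq_zero_iff_exists {S : Matrix ι ι ℝ} (hS : S.IsHermitian)
    (v : ι → ℝ) : S.mulVec v = 0 ↔ ∃ u, (S.kernelPolynomial S.rank).mulVec u = v := by
  obtain ⟨q, hq0, hdeg, hq⟩ := hS.charpoly_eq_X_pow_mul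
  rw [Matrix.kernelPolynomial_eq_aeval hdeg hq]
  constructor
  · intro hv
    refine ⟨(q.coeff 0)⁻¹ • v, ?_⟩
    have hdecomp : Polynomial.aeval S q = Polynomial.aeval S q.divX * S + q.coeff 0 • 1 := by
      conv_lhs => rw [← q.divX_mul_X_add]
      simp [Algebra.algebraMap_eq_smul_one]
    rw [Matrix.mulVec_smul, hdecomp, Matrix.add_mulVec, ← Matrix.mulVec_mulVec, hv,
      Matrix.mulVec_zero, zero_add, Matrix.smul_mulVec, Matrix.one_mulVec, smul_smul,
      inv_mul_cancel₀ hq0, one_smul]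
  · rintro ⟨u, rfl⟩
    have hCH := S.aeval_self_charpoly
    rw [hq, map_mul, map_pow, Polynomial.aeval_X] at hCH
    rw [Matrix.mulVec_mulVec, hS.mul_eq_zero_of_pow_mul_eq_zero _ hCH, Matrix.zero_mulVec]

end KernelPolynomial

/-- A symbol of constant rank admits an exact potential. -/
theorem exists_exact_potential {n k r : ℕ} (hn : 1 ≤ n)
    {W X : Type*} [AddCommGroup W] [Module ℝ W] [FiniteDimensional ℝ W]
    [AddCommGroup X] [Module ℝ X] [FiniteDimensional ℝ X]
    (Acoef : (Fin n → ℕ) → (W →ₗ[ℝ] X))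
    (h : ∀ ξ : Fin n → ℝ, ξ ≠ 0 →
      Module.finrank ℝ (LinearMap.range (symbolOf k Acoef ξ)) = r) :
    ∃ (l m : ℕ) (Bcoef : (Fin n → ℕ) → (EuclideanSpace ℝ (Fin m) →ₗ[ℝ] W)),
      ∀ ξ : Fin n → ℝ, ξ ≠ 0 →
        LinearMap.ker (symbolOf k Acoef ξ) = LinearMap.range (symbolOf l Bcoef ξ) := by
  let b := Module.finBasis ℝ W
  let c := Module.finBasis ℝ X
  let e := (EuclideanSpace.basisFun (Fin (Module.finrank ℝ W)) ℝ).toBasis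
  have hr : r ≤ Fintype.card (Fin (Module.finrank ℝ W)) := by
    have hone : (fun _ => 1 : Fin n → ℝ) ≠ 0 := fun h0 =>
      one_ne_zero (congrFun h0 ⟨0, hn⟩)
    rw [← h _ hone, Fintype.card_fin]
    exact LinearMap.finrank_range_le _
  have hent (i : Fin (Module.finrank ℝ X)) (j : Fin (Module.finrank ℝ W)) :=
    exists_isHomogeneous_eval_eq_symbolOf k Acoef (c.coord i ∘ₗ LinearMap.applyₗ (b j))
  choose N hNhom hN using hent
  have hNmap (ξ : Fin n → ℝ) : (Matrix.of N).map (MvPolynomial.eval ξ) =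
      LinearMap.toMatrix b c (symbolOf k Acoef ξ) := by
    ext i j
    simp [hN, LinearMap.toMatrix_apply]
  have hMhom (i j) : (((Matrix.of N).transpose * Matrix.of N) i j).IsHomogeneous (k + k) := by
    rw [Matrix.mul_apply]
    exact MvPolynomial.IsHomogeneous.sum _ _ _ fun x _ => (hNhom x i).mul (hNhom x j)
  obtain ⟨Bcoef, hB⟩ := exists_symbolOf_eq_map_eval _ _
    (Matrix.isHomogeneous_kernelPolynomial hMhom hr) (Matrix.toLin e b).toLinearMap
  refine ⟨(k + k) * r, _, Bcoef, fun ξ hξ => ?_⟩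
  rw [hB, Matrix.kernelPolynomial_map, Matrix.map_mul, Matrix.transpose_map, hNmap]
  set T := LinearMap.toMatrix b c (symbolOf k Acoef ξ) with hT
  have hS : (T.transpose * T).IsHermitian := by
    simpa using Matrix.isHermitian_conjTranspose_mul_self T
  have hrank : (T.transpose * T).rank = r := by
    rw [Matrix.rank_transpose_mul_self, Matrix.rank_eq_finrank_range_toLin T c b, hT,
      Matrix.toLin_toMatrix, h ξ hξ]
  ext w
  have hker : symbolOf k Acoef ξ w = 0 ↔ (T.transpose * T).mulVec (b.repr w) = 0 := by
    have h1 := Matrix.conjTranspose_mul_self_mulVec_eq_zero T (b.repr w)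
    rw [Matrix.conjTranspose_eq_transpose_of_trivial] at h1
    rw [h1, hT, LinearMap.toMatrix_mulVec_repr]
    simp
  rw [LinearMap.mem_ker, hker, hS.mulVec_eq_zero_iff_exists, hrank, LinearMap.mem_range]
  set K := (T.transpose * T).kernelPolynomial r
  have hrepr (v) : b.repr (Matrix.toLin e b K v) = K.mulVec (e.repr v) := by
    rw [← LinearMap.toMatrix_mulVec_repr e b, LinearMap.toMatrix_toLin]
  constructor
  · rintro ⟨u, hu⟩
    refine ⟨e.equivFun.symm u, b.equivFun.injective ?_⟩
    exact (hrepr _).trans ((congrArg K.mulVec (e.equivFun.apply_symm_apply u)).trans hu)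
  · rintro ⟨v, rfl⟩
    exact ⟨e.repr v, (hrepr v).symm⟩

/-- **Theorem 1 (existence of potentials).** A `k`-homogeneous constant-coefficient symbol
`A(ξ) = ∑_{|α|=k} ξ^α A_α` with values in `Lin(W, X)` has constant rank on `ℝ^n \ {0}`
if and only if there exist `l ∈ ℕ`, a finite-dimensional real inner product space `V`
(taken to be `EuclideanSpace ℝ (Fin m)`), and an `l`-homogeneous symbol
`B(ξ) = ∑_{|β|=l} ξ^β B_β` with values in `Lin(V, W)` such that
`ker A(ξ) = im B(ξ)` for all `ξ ≠ 0`. -/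
theorem constant_rank_iff_exact_potential
    {n k : ℕ} (hn : 1 ≤ n) (hk : 1 ≤ k)
    {W X : Type*}
    [NormedAddCommGroup W] [InnerProductSpace ℝ W] [FiniteDimensional ℝ W]
    [NormedAddCommGroup X] [InnerProductSpace ℝ X] [FiniteDimensional ℝ X]
    (Acoef : (Fin n → ℕ) → (W →ₗ[ℝ] X)) :
    (∃ r : ℕ, ∀ ξ : Fin n → ℝ, ξ ≠ 0 →
        Module.finrank ℝ (LinearMap.range (symbolOf k Acoef ξ)) = r)
      ↔
    (∃ (l m : ℕ) (Bcoef : (Fin n → ℕ) → (EuclideanSpace ℝ (Fin m) →ₗ[ℝ] W)),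
        ∀ ξ : Fin n → ℝ, ξ ≠ 0 →
          LinearMap.ker (symbolOf k Acoef ξ) = LinearMap.range (symbolOf l Bcoef ξ)) := by
  constructor
  · rintro ⟨r, h⟩
    exact exists_exact_potential hn Acoef h
  · rintro ⟨l, m, Bcoef, h⟩
    have hone : (fun _ => 1 : Fin n → ℝ) ≠ 0 := fun h0 =>
      one_ne_zero (congrFun h0 ⟨0, hn⟩)
    exact ⟨_, fun ξ hξ => le_antisymm
      (finrank_range_symbolOf_le_of_exact hn Acoef Bcoef h ξ _ hone)
      (finrank_range_symbolOf_le_of_exact hn Acoef Bcoef h _ ξ hξ)⟩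
end

section
/- Let A(ξ) = Σ_{|α|=k} ξ^α A_α be a k-homogeneous symbol on ℝ^n with values in Lin(W,X), with constant rank r ≥ 1 on ℝ^n \ {0}. Set N = dim X and, for each ξ, define e_0(ξ),…,e_N(ξ) by det(λ Id_X − A(ξ)A(ξ)*) = Σ_{j=0}^N (−1)^j e_j(ξ) λ^{N−j}. Then the map B(ξ) := e_r(ξ)(Id_W − A†(ξ)A(ξ)), where A†(ξ) denotes the Moore–Penrose pseudoinverse of A(ξ), has all matrix entries equal to homogeneous polynomials in ξ of degree 2kr, and satisfies im B(ξ) = ker A(ξ) for every ξ ∈ ℝ^n \ {0}. -/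
open scoped BigOperators

theorem LinearMap.IsSymmetric.apply_eq_zero_of_pow_apply_eq_zero {E : Type*} [NormedAddCommGroup E]
    [InnerProductSpace ℝ E] [FiniteDimensional ℝ E] {T : E →ₗ[ℝ] E} (hT : T.IsSymmetric)
    {m : ℕ} {x : E} (hx : (T ^ m) x = 0) : T x = 0 := by
  have h := hT.isFinitelySemisimple.maxGenEigenspace_eq_eigenspace 0
  have hmem : x ∈ Module.End.maxGenEigenspace T 0 := by
    rw [Module.End.mem_maxGenEigenspace]
    exact ⟨m, by simpa using hx⟩
  rw [h, Module.End.mem_eigenspace_iff] at hmem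
  simpa using hmem

theorem LinearMap.IsSymmetric.natTrailingDegree_charpoly {E : Type*} [NormedAddCommGroup E]
    [InnerProductSpace ℝ E] [FiniteDimensional ℝ E] {T : E →ₗ[ℝ] E} (hT : T.IsSymmetric) :
    T.charpoly.natTrailingDegree = Module.finrank ℝ (LinearMap.ker T) := by
  rw [← LinearMap.finrank_maxGenEigenspace_zero_eq,
    hT.isFinitelySemisimple.maxGenEigenspace_eq_eigenspace 0, Module.End.eigenspace_zero]

section Adjoint

variable {W X : Type*}
  [NormedAddCommGroup W] [InnerProductSpace ℝ W] [FiniteDimensional ℝ W]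
  [NormedAddCommGroup X] [InnerProductSpace ℝ X] [FiniteDimensional ℝ X]

theorem LinearMap.eq_zero_of_comp_adjoint_apply_eq_zero (A : W →ₗ[ℝ] X) {x : X}
    (hx : A (LinearMap.adjoint A x) = 0) : LinearMap.adjoint A x = 0 := by
  rw [← inner_self_eq_zero (𝕜 := ℝ), LinearMap.adjoint_inner_left, hx, inner_zero_right]

theorem LinearMap.isSymmetric_comp_adjoint (A : W →ₗ[ℝ] X) :
    (A ∘ₗ LinearMap.adjoint A).IsSymmetric := by
  intro x y
  rw [LinearMap.comp_apply, LinearMap.comp_apply, ← LinearMap.adjoint_inner_right,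
    LinearMap.adjoint_inner_left]

theorem LinearMap.finrank_ker_comp_adjoint (A : W →ₗ[ℝ] X) :
    Module.finrank ℝ (LinearMap.range A) +
      Module.finrank ℝ (LinearMap.ker (A ∘ₗ LinearMap.adjoint A)) = Module.finrank ℝ X := by
  have h : LinearMap.ker (A ∘ₗ LinearMap.adjoint A) = (LinearMap.range A)ᗮ := by
    ext x
    rw [LinearMap.mem_ker, LinearMap.comp_apply, Submodule.mem_orthogonal]
    constructor
    · rintro hx _ ⟨w, rfl⟩
      rw [← LinearMap.adjoint_inner_right, A.eq_zero_of_comp_adjoint_apply_eq_zero hx,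
        inner_zero_right]
    · intro hx
      have h0 : LinearMap.adjoint A x = 0 := by
        rw [← inner_self_eq_zero (𝕜 := ℝ), LinearMap.adjoint_inner_right]
        exact hx _ ⟨_, rfl⟩
      rw [h0, map_zero]
  rw [h, Submodule.finrank_add_finrank_orthogonal]

theorem LinearMap.pow_adjoint_comp_apply_adjoint (A : W →ₗ[ℝ] X) (i : ℕ) (x : X) :
    ((LinearMap.adjoint A ∘ₗ A) ^ i) (LinearMap.adjoint A x) =
      LinearMap.adjoint A (((A ∘ₗ LinearMap.adjoint A) ^ i) x) := by
  induction i generalizing x with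
  | zero => simp
  | succ i ih =>
    rw [pow_succ, pow_succ, Module.End.mul_apply, Module.End.mul_apply]
    exact ih (A (LinearMap.adjoint A x))

theorem LinearMap.coeff_charpoly_comp_adjoint_ne_zero (A : W →ₗ[ℝ] X) :
    (A ∘ₗ LinearMap.adjoint A).charpoly.coeff
      (Module.finrank ℝ X - Module.finrank ℝ (LinearMap.range A)) ≠ 0 := by
  have h1 := A.isSymmetric_comp_adjoint.natTrailingDegree_charpoly
  have h2 := A.finrank_ker_comp_adjoint
  have h3 : Module.finrank ℝ X - Module.finrank ℝ (LinearMap.range A) =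
      (A ∘ₗ LinearMap.adjoint A).charpoly.natTrailingDegree := by omega
  rw [h3]
  exact Polynomial.trailingCoeff_nonzero_iff_nonzero.mpr (LinearMap.charpoly_monic _).ne_zero

/-- If `q(λ)` is the characteristic polynomial of `A A*` divided by its power of `λ`, then
`A* q(A A*) = 0`. -/
theorem LinearMap.adjoint_apply_sum_coeff_charpoly (A : W →ₗ[ℝ] X) (x : X) :
    LinearMap.adjoint A ((∑ i ∈ Finset.range (Module.finrank ℝ (LinearMap.range A) + 1),
      (A ∘ₗ LinearMap.adjoint A).charpoly.coeff
        (Module.finrank ℝ X - Module.finrank ℝ (LinearMap.range A) + i) •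
          (A ∘ₗ LinearMap.adjoint A) ^ i) x) = 0 := by
  set T := A ∘ₗ LinearMap.adjoint A with hT
  have h1 := A.isSymmetric_comp_adjoint.natTrailingDegree_charpoly
  have h2 := A.finrank_ker_comp_adjoint
  set r := Module.finrank ℝ (LinearMap.range A)
  set m := Module.finrank ℝ X - r with hm
  rw [← hT] at h1 h2
  have hmd : m = T.charpoly.natTrailingDegree := by omega
  obtain ⟨q, hq⟩ : Polynomial.X ^ m ∣ T.charpoly := by
    rw [Polynomial.X_pow_dvd_iff]
    intro d hd
    exact Polynomial.coeff_eq_zero_of_lt_natTrailingDegree (hmd ▸ hd)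
  have hcoeff (i : ℕ) : T.charpoly.coeff (m + i) = q.coeff i := by
    rw [hq, add_comm, Polynomial.coeff_X_pow_mul]
  have hdeg : q.natDegree < r + 1 := by
    rw [Nat.lt_succ_iff, Polynomial.natDegree_le_iff_coeff_eq_zero]
    intro i hi
    rw [← hcoeff]
    apply Polynomial.coeff_eq_zero_of_natDegree_lt
    rw [LinearMap.charpoly_natDegree]
    omega
  have hsum : ∑ i ∈ Finset.range (r + 1), T.charpoly.coeff (m + i) • T ^ i =
      Polynomial.aeval T q := by
    rw [Polynomial.aeval_eq_sum_range' hdeg]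
    simp only [hcoeff]
  rw [hsum]
  apply A.eq_zero_of_comp_adjoint_apply_eq_zero
  have hz : (T ^ m) (Polynomial.aeval T q x) = 0 := by
    have := T.aeval_self_charpoly
    rw [hq, map_mul, map_pow, Polynomial.aeval_X] at this
    simpa using LinearMap.congr_fun this x
  exact A.isSymmetric_comp_adjoint.apply_eq_zero_of_pow_apply_eq_zero hz

/-- A multiple of the orthogonal projection onto `ker A` as a polynomial in `A* A`. -/
theorem LinearMap.smul_id_sub_pinv_comp_eq (A : W →ₗ[ℝ] X) (D : X →ₗ[ℝ] W)
    (h1 : A ∘ₗ D ∘ₗ A = A) (h2 : LinearMap.adjoint (D ∘ₗ A) = D ∘ₗ A) (r : ℕ) (c : ℕ → ℝ)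
    (hc : ∀ x, LinearMap.adjoint A
      ((∑ i ∈ Finset.range (r + 1), c i • (A ∘ₗ LinearMap.adjoint A) ^ i) x) = 0) :
    c 0 • (LinearMap.id - D ∘ₗ A) =
      ∑ i ∈ Finset.range (r + 1), c i • (LinearMap.adjoint A ∘ₗ A) ^ i := by
  ext w
  have hDA : D (A w) = LinearMap.adjoint A (LinearMap.adjoint D w) := by
    rw [← LinearMap.comp_apply, ← h2, LinearMap.adjoint_comp, LinearMap.comp_apply]
  have hw : A (w - D (A w)) = 0 := by
    rw [map_sub, sub_eq_zero]
    exact (LinearMap.congr_fun h1 w).symm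
  have hker : (∑ i ∈ Finset.range (r + 1), c i • (LinearMap.adjoint A ∘ₗ A) ^ i)
      (w - D (A w)) = c 0 • (w - D (A w)) := by
    rw [LinearMap.sum_apply, Finset.sum_range_succ', Finset.sum_eq_zero]
    · simp
    · intro i _
      rw [pow_succ, LinearMap.smul_apply, Module.End.mul_apply, LinearMap.comp_apply, hw]
      simp
  have hran : (∑ i ∈ Finset.range (r + 1), c i • (LinearMap.adjoint A ∘ₗ A) ^ i)
      (D (A w)) = 0 := by
    rw [hDA, ← hc (LinearMap.adjoint D w)]
    simp only [LinearMap.sum_apply, LinearMap.smul_apply, map_sum, map_smul,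
      LinearMap.pow_adjoint_comp_apply_adjoint]
  have := congrArg₂ (· + ·) hker hran
  simp only [← map_add, sub_add_cancel, add_zero] at this
  rw [this]
  simp

end Adjoint

/-- `f` is the polynomial function of a homogeneous polynomial of degree `d`. -/
def IsHomogeneousPolyFun {n : ℕ} (d : ℕ) (f : (Fin n → ℝ) → ℝ) : Prop :=
  ∃ p : MvPolynomial (Fin n) ℝ, p.IsHomogeneous d ∧ ∀ ξ, f ξ = MvPolynomial.eval ξ p

namespace IsHomogeneousPolyFun

variable {n d d' : ℕ} {f g : (Fin n → ℝ) → ℝ}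

theorem mul (hf : IsHomogeneousPolyFun d f) (hg : IsHomogeneousPolyFun d' g) :
    IsHomogeneousPolyFun (d + d') (fun ξ => f ξ * g ξ) := by
  obtain ⟨p, hp, hfp⟩ := hf
  obtain ⟨q, hq, hgq⟩ := hg
  exact ⟨p * q, hp.mul hq, fun ξ => by simp [hfp, hgq]⟩

theorem const (c : ℝ) : IsHomogeneousPolyFun (n := n) 0 (fun _ => c) :=
  ⟨MvPolynomial.C c, MvPolynomial.isHomogeneous_C _ _, fun ξ => by simp⟩

theorem sum {ι : Type*} {s : Finset ι} {F : ι → (Fin n → ℝ) → ℝ}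
    (hF : ∀ i ∈ s, IsHomogeneousPolyFun d (F i)) :
    IsHomogeneousPolyFun d (fun ξ => ∑ i ∈ s, F i ξ) := by
  choose! p hp hFp using hF
  refine ⟨∑ i ∈ s, p i, MvPolynomial.IsHomogeneous.sum _ _ _ hp, fun ξ => ?_⟩
  rw [map_sum]
  exact Finset.sum_congr rfl fun i hi => hFp i hi ξ

theorem prod_pow (α : Fin n → ℕ) :
    IsHomogeneousPolyFun (∑ i, α i) (fun ξ => ∏ i, ξ i ^ α i) := by
  refine ⟨∏ i, MvPolynomial.X i ^ α i, ?_, fun ξ => by simp⟩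
  exact MvPolynomial.IsHomogeneous.prod _ _ _ fun i _ => MvPolynomial.isHomogeneous_X_pow i (α i)

theorem apply_zero (hf : IsHomogeneousPolyFun d f) (hd : 1 ≤ d) : f 0 = 0 := by
  obtain ⟨p, hp, hfp⟩ := hf
  rw [hfp, MvPolynomial.eval_zero, MvPolynomial.constantCoeff_eq]
  exact hp.coeff_eq_zero (by simp; omega)

end IsHomogeneousPolyFun

/-- All matrix entries of `T` are homogeneous polynomials of degree `d`. -/
def IsHomogeneousPolyMap {n : ℕ} {V U : Type*} [AddCommGroup V] [Module ℝ V]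
    [AddCommGroup U] [Module ℝ U] (d : ℕ) (T : (Fin n → ℝ) → (V →ₗ[ℝ] U)) : Prop :=
  ∀ (φ : U →ₗ[ℝ] ℝ) (v : V), IsHomogeneousPolyFun d (fun ξ => φ (T ξ v))

namespace IsHomogeneousPolyMap

variable {n d d' : ℕ}

section Module

variable {V U Z : Type*} [AddCommGroup V] [Module ℝ V] [AddCommGroup U] [Module ℝ U]
  [AddCommGroup Z] [Module ℝ Z]

theorem of_symbolOf (k : ℕ) (coef : (Fin n → ℕ) → (V →ₗ[ℝ] U)) :
    IsHomogeneousPolyMap k (symbolOf k coef) := by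
  intro φ v
  simp only [symbolOf, LinearMap.sum_apply, LinearMap.smul_apply, map_sum, map_smul,
    smul_eq_mul]
  refine IsHomogeneousPolyFun.sum fun α hα => ?_
  rw [Finset.Nat.mem_antidiagonalTuple] at hα
  simpa [hα] using
    (IsHomogeneousPolyFun.prod_pow α).mul (IsHomogeneousPolyFun.const (φ (coef α v)))

theorem comp [FiniteDimensional ℝ U] {S : (Fin n → ℝ) → (U →ₗ[ℝ] Z)}
    {T : (Fin n → ℝ) → (V →ₗ[ℝ] U)} (hS : IsHomogeneousPolyMap d S)
    (hT : IsHomogeneousPolyMap d' T) : IsHomogeneousPolyMap (d + d') (fun ξ => S ξ ∘ₗ T ξ) := by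
  intro φ v
  let b := Module.finBasis ℝ U
  have h : (fun ξ => φ ((S ξ ∘ₗ T ξ) v)) =
      fun ξ => ∑ i, φ (S ξ (b i)) * b.coord i (T ξ v) := by
    funext ξ
    conv_lhs => rw [LinearMap.comp_apply, ← b.sum_repr (T ξ v), map_sum, map_sum]
    simp only [map_smul, smul_eq_mul, Module.Basis.coord_apply, mul_comm]
  rw [h]
  exact IsHomogeneousPolyFun.sum fun i _ => (hS φ (b i)).mul (hT (b.coord i) v)

theorem pow [FiniteDimensional ℝ V] {T : (Fin n → ℝ) → (V →ₗ[ℝ] V)}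
    (hT : IsHomogeneousPolyMap d T) (i : ℕ) : IsHomogeneousPolyMap (d * i) (fun ξ => T ξ ^ i) := by
  induction i with
  | zero => exact fun φ v => by simpa using IsHomogeneousPolyFun.const (φ v)
  | succ i ih => simpa only [pow_succ, Module.End.mul_eq_comp, Nat.mul_succ] using ih.comp hT

theorem smul {f : (Fin n → ℝ) → ℝ} {T : (Fin n → ℝ) → (V →ₗ[ℝ] U)}
    (hf : IsHomogeneousPolyFun d f) (hT : IsHomogeneousPolyMap d' T) :
    IsHomogeneousPolyMap (d + d') (fun ξ => f ξ • T ξ) := by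
  intro φ v
  simpa using hf.mul (hT φ v)

theorem sum {ι : Type*} {s : Finset ι} {T : ι → (Fin n → ℝ) → (V →ₗ[ℝ] U)}
    (hT : ∀ i ∈ s, IsHomogeneousPolyMap d (T i)) :
    IsHomogeneousPolyMap d (fun ξ => ∑ i ∈ s, T i ξ) := by
  intro φ v
  simpa using IsHomogeneousPolyFun.sum fun i hi => hT i hi φ v

theorem coeff_charpoly [FiniteDimensional ℝ V] {T : (Fin n → ℝ) → (V →ₗ[ℝ] V)}
    (hT : IsHomogeneousPolyMap d T) {i j : ℕ} (hij : i + j = Module.finrank ℝ V) :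
    IsHomogeneousPolyFun (d * j) (fun ξ => (T ξ).charpoly.coeff i) := by
  let b := Module.finBasis ℝ V
  choose p hp hpT using fun ab : Fin (Module.finrank ℝ V) × Fin (Module.finrank ℝ V) =>
    hT (b.coord ab.1) (b ab.2)
  refine ⟨MvPolynomial.aeval p ((Matrix.charpoly.univ ℝ (Fin (Module.finrank ℝ V))).coeff i),
    (Matrix.charpoly.univ_coeff_isHomogeneous ℝ _ i j (by simpa using hij)).aeval p hp,
    fun ξ => ?_⟩
  beta_reduce
  have hM : LinearMap.toMatrix b b (T ξ) =
      Matrix.of (Function.curry fun ab => MvPolynomial.eval ξ (p ab)) := by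
    ext x y
    simp [LinearMap.toMatrix_apply, ← hpT (x, y) ξ]
  rw [← LinearMap.charpoly_toMatrix (T ξ) b, hM,
    ← Matrix.charpoly.univ_coeff_eval₂Hom _ (RingHom.id ℝ), MvPolynomial.map_aeval]
  congr 2
  ext
  simp

end Module

theorem adjoint {W X : Type*}
    [NormedAddCommGroup W] [InnerProductSpace ℝ W] [FiniteDimensional ℝ W]
    [NormedAddCommGroup X] [InnerProductSpace ℝ X] [FiniteDimensional ℝ X]
    {A : (Fin n → ℝ) → (W →ₗ[ℝ] X)} (hA : IsHomogeneousPolyMap d A) :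
    IsHomogeneousPolyMap d (fun ξ => LinearMap.adjoint (A ξ)) := by
  intro φ x
  obtain ⟨w, hw⟩ := (InnerProductSpace.toDual ℝ W).surjective φ.toContinuousLinearMap
  have hφ (v : W) : φ v = inner ℝ w v := by
    rw [← InnerProductSpace.toDual_apply_apply, hw]
    rfl
  simp only [hφ, LinearMap.adjoint_inner_right, real_inner_comm x]
  exact hA (innerₛₗ ℝ x) w

end IsHomogeneousPolyMap

/-- The coefficients in an expansion of `det (λ - T)` are those of the characteristic
polynomial. -/
theorem LinearMap.coeff_charpoly_eq_of_det_eq_sum {V : Type*} [AddCommGroup V] [Module ℝ V]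
    [FiniteDimensional ℝ V] (T : V →ₗ[ℝ] V) (N : ℕ) (a : ℕ → ℝ)
    (h : ∀ l : ℝ, LinearMap.det (l • (LinearMap.id : V →ₗ[ℝ] V) - T) =
      ∑ j ∈ Finset.range (N + 1), a j * l ^ (N - j))
    {j : ℕ} (hj : j ≤ N) : T.charpoly.coeff (N - j) = a j := by
  have hP : T.charpoly =
      ∑ j ∈ Finset.range (N + 1), Polynomial.C (a j) * Polynomial.X ^ (N - j) := by
    refine Polynomial.funext fun l => ?_
    rw [LinearMap.eval_charpoly, Polynomial.eval_finsetSum]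
    simp only [Polynomial.eval_mul, Polynomial.eval_C, Polynomial.eval_pow, Polynomial.eval_X]
    exact h l
  rw [hP, Polynomial.finsetSum_coeff, Finset.sum_eq_single j]
  · simp
  · intro i hi hij
    rw [Finset.mem_range] at hi
    rw [Polynomial.coeff_C_mul_X_pow, if_neg (by omega)]
  · intro h
    simp at h
    omega

/-- **Construction of the potential.** Let `A(ξ)` be a `k`-homogeneous symbol of constant
rank `r ≥ 1` on `ℝ^n \ {0}`, let `N = dim X`, let `e_0(ξ), …, e_N(ξ)` be the
sign-normalized coefficients of the characteristic polynomial of `A(ξ)A(ξ)*`, i.e.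
`det(λ Id_X − A(ξ)A(ξ)*) = ∑_{j=0}^N (−1)^j e_j(ξ) λ^{N−j}`, and let `A†(ξ)` be the
Moore–Penrose pseudoinverse of `A(ξ)`. Then `B(ξ) := e_r(ξ) (Id_W − A†(ξ) A(ξ))` has all
matrix entries homogeneous polynomials in `ξ` of degree `2kr`, and
`im B(ξ) = ker A(ξ)` for all `ξ ≠ 0`. -/
theorem potential_polynomial_and_exact
    {n k : ℕ} (hn : 1 ≤ n) (hk : 1 ≤ k)
    {W X : Type*}
    [NormedAddCommGroup W] [InnerProductSpace ℝ W] [FiniteDimensional ℝ W]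
    [NormedAddCommGroup X] [InnerProductSpace ℝ X] [FiniteDimensional ℝ X]
    (Acoef : (Fin n → ℕ) → (W →ₗ[ℝ] X))
    (A : (Fin n → ℝ) → (W →ₗ[ℝ] X)) (hA : ∀ ξ, A ξ = symbolOf k Acoef ξ)
    (r : ℕ) (hr : 1 ≤ r)
    (hrank : ∀ ξ : Fin n → ℝ, ξ ≠ 0 → Module.finrank ℝ (LinearMap.range (A ξ)) = r)
    (N : ℕ) (hN : N = Module.finrank ℝ X)
    (e : ℕ → (Fin n → ℝ) → ℝ)
    (he : ∀ (ξ : Fin n → ℝ) (lam : ℝ),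
      LinearMap.det (lam • (LinearMap.id : X →ₗ[ℝ] X) - (A ξ) ∘ₗ (LinearMap.adjoint (A ξ)))
        = ∑ j ∈ Finset.range (N + 1), (-1 : ℝ) ^ j * e j ξ * lam ^ (N - j))
    (Adag : (Fin n → ℝ) → (X →ₗ[ℝ] W))
    (hdag : ∀ ξ : Fin n → ℝ,
      (A ξ) ∘ₗ (Adag ξ) ∘ₗ (A ξ) = A ξ ∧
      (Adag ξ) ∘ₗ (A ξ) ∘ₗ (Adag ξ) = Adag ξ ∧
      LinearMap.adjoint ((A ξ) ∘ₗ (Adag ξ)) = (A ξ) ∘ₗ (Adag ξ) ∧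
      LinearMap.adjoint ((Adag ξ) ∘ₗ (A ξ)) = (Adag ξ) ∘ₗ (A ξ))
    (B : (Fin n → ℝ) → (W →ₗ[ℝ] W))
    (hB : ∀ ξ, B ξ = e r ξ • ((LinearMap.id : W →ₗ[ℝ] W) - (Adag ξ) ∘ₗ (A ξ))) :
    (∀ (φ : W →ₗ[ℝ] ℝ) (w : W), ∃ p : MvPolynomial (Fin n) ℝ,
        p.IsHomogeneous (2 * k * r) ∧ ∀ ξ : Fin n → ℝ, φ (B ξ w) = MvPolynomial.eval ξ p) ∧
    (∀ ξ : Fin n → ℝ, ξ ≠ 0 → LinearMap.range (B ξ) = LinearMap.ker (A ξ)) := by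
  have hApoly : IsHomogeneousPolyMap k A := by
    rw [funext hA]
    exact IsHomogeneousPolyMap.of_symbolOf k Acoef
  have hrN : r ≤ N := by
    have h1 : (fun _ => 1 : Fin n → ℝ) ≠ 0 := fun h =>
      one_ne_zero (congrFun h ⟨0, hn⟩)
    rw [hN, ← hrank _ h1]
    exact Submodule.finrank_le _
  have hcoeff (ξ : Fin n → ℝ) :
      (A ξ ∘ₗ LinearMap.adjoint (A ξ)).charpoly.coeff (N - r) = (-1) ^ r * e r ξ :=
    LinearMap.coeff_charpoly_eq_of_det_eq_sum _ N (fun j => (-1) ^ j * e j ξ) (he ξ) hrN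
  have her (ξ : Fin n → ℝ) :
      e r ξ = (-1) ^ r * (A ξ ∘ₗ LinearMap.adjoint (A ξ)).charpoly.coeff (N - r) := by
    rw [hcoeff, ← mul_assoc, ← mul_pow]
    simp
  have hannih (ξ : Fin n → ℝ) (x : X) : LinearMap.adjoint (A ξ)
      ((∑ i ∈ Finset.range (r + 1), (A ξ ∘ₗ LinearMap.adjoint (A ξ)).charpoly.coeff (N - r + i) •
        (A ξ ∘ₗ LinearMap.adjoint (A ξ)) ^ i) x) = 0 := by
    by_cases hξ : ξ = 0
    · have h0 : A ξ = 0 := by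
        ext w
        refine ext_inner_left ℝ fun v => ?_
        simpa [hξ] using (hApoly (innerₛₗ ℝ v) w).apply_zero hk
      rw [h0, map_zero, LinearMap.zero_apply]
    · have := (A ξ).adjoint_apply_sum_coeff_charpoly x
      rwa [hrank ξ hξ, ← hN] at this
  have hBeq (ξ : Fin n → ℝ) : B ξ = (-1 : ℝ) ^ r • ∑ i ∈ Finset.range (r + 1),
      (A ξ ∘ₗ LinearMap.adjoint (A ξ)).charpoly.coeff (N - r + i) •
        (LinearMap.adjoint (A ξ) ∘ₗ A ξ) ^ i := by
    rw [hB, her, mul_smul, ← LinearMap.smul_id_sub_pinv_comp_eq (A ξ) (Adag ξ) (hdag ξ).1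
      (hdag ξ).2.2.2 r _ (hannih ξ), add_zero]
  refine ⟨fun φ w => ?_, fun ξ hξ => ?_⟩
  · suffices h : IsHomogeneousPolyMap (2 * k * r) B from h φ w
    rw [funext hBeq, ← zero_add (2 * k * r)]
    refine IsHomogeneousPolyMap.smul (IsHomogeneousPolyFun.const _)
      (IsHomogeneousPolyMap.sum fun i hi => ?_)
    rw [Finset.mem_range] at hi
    have hdeg : 2 * k * r = (k + k) * (r - i) + (k + k) * i := by
      rw [← mul_add, Nat.sub_add_cancel (by omega), two_mul]
    rw [hdeg]
    exact IsHomogeneousPolyMap.smul ((hApoly.comp hApoly.adjoint).coeff_charpoly (by omega))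
      ((hApoly.adjoint.comp hApoly).pow i)
  · have he0 : e r ξ ≠ 0 := by
      intro h
      have h1 := (A ξ).coeff_charpoly_comp_adjoint_ne_zero
      rw [hrank ξ hξ, ← hN, hcoeff, h, mul_zero] at h1
      exact h1 rfl
    have hADA (w : W) : A ξ (Adag ξ (A ξ w)) = A ξ w := LinearMap.congr_fun (hdag ξ).1 w
    ext w
    rw [hB, LinearMap.mem_range, LinearMap.mem_ker]
    constructor
    · rintro ⟨v, rfl⟩
      simp [hADA]
    · intro hw
      exact ⟨(e r ξ)⁻¹ • w, by simp [hw, he0]⟩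
end

section
/- Let S ⊂ ℝ^n be a set of positive Lebesgue measure and let P and Q be two matrix-valued polynomials on ℝ^n. Suppose there exists s ∈ ℕ such that rank P(ξ) + rank Q(ξ) = s for all ξ ∈ S. Then both P and Q have constant rank on S, i.e., there exist r₁, r₂ ∈ ℕ with rank P(ξ) = r₁ and rank Q(ξ) = r₂ for all ξ ∈ S. -/
open MeasureTheory
open scoped BigOperators

/-- A nonzero real polynomial is nonzero almost everywhere. -/
theorem MvPolynomial.ae_eval_ne_zero {n : ℕ} {p : MvPolynomial (Fin n) ℝ} (hp : p ≠ 0) :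
    ∀ᵐ ξ : Fin n → ℝ, MvPolynomial.eval ξ p ≠ 0 := by
  induction n with
  | zero =>
    refine Filter.Eventually.of_forall fun ξ h => hp (MvPolynomial.funext fun η => ?_)
    rw [Subsingleton.elim η ξ, h, map_zero]
  | succ n ih =>
    have hq : MvPolynomial.finSuccEquiv ℝ n p ≠ 0 := by simpa using hp
    set q := MvPolynomial.finSuccEquiv ℝ n p
    let Z : Set (ℝ × (Fin n → ℝ)) := {z | MvPolynomial.eval (Fin.cons z.1 z.2) p = 0}
    have hcont : Continuous fun z : ℝ × (Fin n → ℝ) =>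
        MvPolynomial.eval (Fin.cons z.1 z.2 : Fin (n + 1) → ℝ) p :=
      p.continuous_eval.comp (Continuous.finCons (A := fun _ => ℝ) continuous_fst continuous_snd)
    have hZ : MeasurableSet Z := (isClosed_singleton.preimage hcont).measurableSet
    have hZ0 : (volume.prod volume) Z = 0 := by
      rw [Measure.prod_apply_symm hZ, lintegral_eq_zero_iff (measurable_measure_prodMk_right hZ)]
      filter_upwards [ih (Polynomial.leadingCoeff_ne_zero.2 hq)] with y hy
      have hqy : q.map (MvPolynomial.eval y) ≠ 0 := fun h => hy <| by
        simpa [Polynomial.coeff_map] using congrArg (Polynomial.coeff · q.natDegree) h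
      refine measure_mono_null (fun x hx => ?_)
        ((Polynomial.finite_setOfPred_isRoot hqy).measure_zero volume)
      rw [Set.mem_ofPred_eq, Polynomial.IsRoot, ← MvPolynomial.eval_eq_eval_mv_eval']
      exact hx
    have hpre := (volume_preserving_piFinSuccAbove (fun _ : Fin (n + 1) => ℝ) 0).measure_preimage
      hZ.nullMeasurableSet
    rw [ae_iff]
    refine measure_mono_null (fun ξ hξ => ?_) (hpre.trans hZ0)
    have : (Fin.cons (ξ 0) (fun i => ξ (Fin.succ i)) : Fin (n + 1) → ℝ) = ξ :=
      Fin.cons_self_tail ξ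
    simpa [Z, Fin.removeNth, this] using hξ

namespace Matrix

variable {m n K : Type*} [Fintype m] [Fintype n] [Field K]

/-- A matrix can be compressed to an invertible square matrix of size its rank. -/
theorem exists_det_mul_mul_ne_zero (A : Matrix m n K) :
    ∃ (L : Matrix (Fin A.rank) m K) (R : Matrix n (Fin A.rank) K), (L * A * R).det ≠ 0 := by
  classical
  let b := Module.finBasis K (LinearMap.range A.mulVecLin)
  choose x hx using fun i => (b i).2
  let R : Matrix n (Fin A.rank) K := (Matrix.of x)ᵀ
  have hAR : (A * R).col = fun i => (b i : m → K) := by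
    ext i j
    rw [← hx i]
    rfl
  have hli : LinearIndependent K (A * R).col := by
    rw [hAR]
    exact b.linearIndependent.map' (Submodule.subtype _) (Submodule.ker_subtype _)
  obtain ⟨g, hg⟩ := (A * R).toLin'.exists_leftInverse_of_injective
    (LinearMap.ker_eq_bot.2 (mulVec_injective_iff.2 hli))
  refine ⟨LinearMap.toMatrix' g, R, ?_⟩
  have hL : LinearMap.toMatrix' g * (A * R) = 1 := by
    rw [← LinearMap.toMatrix'_toLin' (A * R), ← LinearMap.toMatrix'_comp, hg,
      LinearMap.toMatrix'_id]
  rw [Matrix.mul_assoc, hL, det_one]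
  exact one_ne_zero

/-- Compressing a matrix to an invertible one bounds its rank from below. -/
theorem card_le_rank_of_det_mul_mul_ne_zero {r : Type*} [Fintype r] [DecidableEq r]
    {A : Matrix m n K} {L : Matrix r m K} {R : Matrix n r K} (h : (L * A * R).det ≠ 0) :
    Fintype.card r ≤ A.rank :=
  calc Fintype.card r = (L * A * R).rank := (rank_of_det_ne_zero h).symm
    _ ≤ (L * A).rank := rank_mul_le_left _ _
    _ ≤ A.rank := rank_mul_le_right _ _

/-- The rank of a polynomial matrix attains its maximum wherever a suitable nonzero polynomial does
not vanish. -/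
theorem exists_ne_zero_forall_rank_map_eval_le {σ : Type*}
    (P : Matrix m n (MvPolynomial σ K)) :
    ∃ p : MvPolynomial σ K, p ≠ 0 ∧ ∀ ξ, MvPolynomial.eval ξ p ≠ 0 →
      ∀ η, (P.map (MvPolynomial.eval η)).rank ≤ (P.map (MvPolynomial.eval ξ)).rank := by
  have hbdd : BddAbove (Set.range fun η : σ → K => (P.map (MvPolynomial.eval η)).rank) :=
    ⟨Fintype.card n, by rintro _ ⟨η, rfl⟩; exact rank_le_card_width _⟩
  obtain ⟨ζ, hζ⟩ := Nat.sSup_mem (Set.range_nonempty _) hbdd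
  obtain ⟨L, R, hLR⟩ := exists_det_mul_mul_ne_zero (P.map (MvPolynomial.eval ζ))
  let p : MvPolynomial σ K :=
    ((L.map MvPolynomial.C : Matrix _ m (MvPolynomial σ K)) * P *
      (R.map MvPolynomial.C : Matrix n _ (MvPolynomial σ K))).det
  have hp (ξ : σ → K) : MvPolynomial.eval ξ p = (L * P.map (MvPolynomial.eval ξ) * R).det := by
    rw [RingHom.map_det, RingHom.mapMatrix_apply, Matrix.map_mul, Matrix.map_mul]
    simp [Matrix.map_map, Function.comp_def]
  refine ⟨p, fun h => hLR ?_, fun ξ hξ η => ?_⟩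
  · rw [← hp, h, map_zero]
  · rw [hp] at hξ
    calc _ ≤ _ := le_csSup hbdd ⟨η, rfl⟩
      _ = _ := hζ.symm
      _ ≤ _ := by simpa using card_le_rank_of_det_mul_mul_ne_zero hξ

end Matrix

/-- **Lemma 2.2.** Let `S ⊆ ℝ^n` have positive Lebesgue measure and let `P`, `Q` be two
matrix-valued polynomials on `ℝ^n` (matrices of multivariate polynomials, evaluated
entrywise). If there is `s ∈ ℕ` with `rank P(ξ) + rank Q(ξ) = s` for all `ξ ∈ S`, then
both `P` and `Q` have constant rank on `S`. -/
theorem constant_rank_on_pos_measure_set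
    {n a b c d : ℕ}
    (S : Set (Fin n → ℝ)) (hS : 0 < volume S)
    (P : Matrix (Fin a) (Fin b) (MvPolynomial (Fin n) ℝ))
    (Q : Matrix (Fin c) (Fin d) (MvPolynomial (Fin n) ℝ))
    (s : ℕ)
    (hsum : ∀ ξ ∈ S, (P.map (MvPolynomial.eval ξ)).rank + (Q.map (MvPolynomial.eval ξ)).rank = s) :
    ∃ r₁ r₂ : ℕ, ∀ ξ ∈ S,
      (P.map (MvPolynomial.eval ξ)).rank = r₁ ∧ (Q.map (MvPolynomial.eval ξ)).rank = r₂ := by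
  obtain ⟨p, hp, hpmax⟩ := P.exists_ne_zero_forall_rank_map_eval_le
  obtain ⟨q, hq, hqmax⟩ := Q.exists_ne_zero_forall_rank_map_eval_le
  have hfreq : ∃ᵐ ξ : Fin n → ℝ, ξ ∈ S := frequently_ae_mem_iff.2 hS.ne'
  obtain ⟨ξ, hξ, hpξ, hqξ⟩ := (hfreq.and_eventually
    ((MvPolynomial.ae_eval_ne_zero hp).and (MvPolynomial.ae_eval_ne_zero hq))).exists
  refine ⟨(P.map (MvPolynomial.eval ξ)).rank, (Q.map (MvPolynomial.eval ξ)).rank, fun η hη => ?_⟩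
  have := hpmax ξ hpξ η
  have := hqmax ξ hqξ η
  have := hsum ξ hξ
  have := hsum η hη
  lia
end

section
/- (Decell's formula) Let M be a real N×m matrix and define e_0,…,e_N ∈ ℝ by det(λ I_N − M Mᵀ) = Σ_{j=0}^N (−1)^j e_j λ^{N−j} (so e_0 = 1), and set r := max{ j ∈ {0,…,N} : e_j ≠ 0 }. Then: if r = 0, the Moore–Penrose pseudoinverse satisfies M† = 0; and if r ≥ 1, then M† = e_r^{−1} Mᵀ Σ_{j=0}^{r−1} (−1)^{r−1−j} e_j (M Mᵀ)^{r−1−j}. -/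
open Matrix
open scoped BigOperators

theorem transpose_mul_eq_zero_of_mul_transpose_pow_mul_eq_zero
    {n m l : Type*} [Fintype n] [DecidableEq n] [Fintype m]
    (M : Matrix n m ℝ) (X : Matrix n l ℝ) (k : ℕ)
    (h : (M * Mᵀ) ^ (k + 1) * X = 0) : Mᵀ * X = 0 := by
  induction k with
  | zero =>
    rw [zero_add, pow_one] at h
    simpa [conjTranspose_eq_transpose_of_trivial] using
      (self_mul_conjTranspose_mul_eq_zero M X).1
        (by simpa [conjTranspose_eq_transpose_of_trivial] using h)
  | succ k ih =>
    apply ih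
    have hA : (M * Mᵀ)ᴴ = M * Mᵀ := by
      simp [conjTranspose_eq_transpose_of_trivial]
    rw [pow_succ', Matrix.mul_assoc]
    apply (conjTranspose_mul_self_mul_eq_zero (M * Mᵀ) ((M * Mᵀ) ^ k * X)).1
    rw [hA, ← Matrix.mul_assoc, ← pow_two, ← pow_add, add_comm 2 k]
    exact h

/-- The Cayley–Hamilton identity for a matrix whose characteristic polynomial is given
by its values. -/
theorem sum_smul_pow_eq_zero_of_det_eq {n : Type*} [Fintype n] [DecidableEq n]
    (A : Matrix n n ℝ) (s : Finset ℕ) (c : ℕ → ℝ) (d : ℕ → ℕ)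
    (h : ∀ t : ℝ, (t • (1 : Matrix n n ℝ) - A).det = ∑ j ∈ s, c j * t ^ d j) :
    ∑ j ∈ s, c j • A ^ d j = 0 := by
  have hp : A.charpoly = ∑ j ∈ s, Polynomial.C (c j) * Polynomial.X ^ d j := by
    apply Polynomial.funext
    intro t
    rw [eval_charpoly, scalar_apply, ← smul_one_eq_diagonal, h t]
    simp [Polynomial.eval_finsetSum]
  have hz := A.aeval_self_charpoly
  rw [hp] at hz
  simpa [Algebra.smul_def] using hz

theorem transpose_mul_sum_eq_zero {N m : ℕ} (M : Matrix (Fin N) (Fin m) ℝ) (e : ℕ → ℝ)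
    (he : ∀ lam : ℝ,
      (lam • (1 : Matrix (Fin N) (Fin N) ℝ) - M * Mᵀ).det
        = ∑ j ∈ Finset.range (N + 1), (-1 : ℝ) ^ j * e j * lam ^ (N - j))
    (r : ℕ) (hr : IsGreatest {j : ℕ | j ≤ N ∧ e j ≠ 0} r) :
    Mᵀ * ∑ j ∈ Finset.range (r + 1), ((-1 : ℝ) ^ j * e j) • (M * Mᵀ) ^ (r - j) = 0 := by
  obtain ⟨⟨hrN, -⟩, hmax⟩ := hr
  have hCH := sum_smul_pow_eq_zero_of_det_eq (M * Mᵀ) _ _ _ he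
  have hfac : (M * Mᵀ) ^ (N - r) *
      ∑ j ∈ Finset.range (r + 1), ((-1 : ℝ) ^ j * e j) • (M * Mᵀ) ^ (r - j) = 0 := by
    rw [← hCH, Finset.mul_sum]
    rw [← Finset.sum_subset (Finset.range_mono (Nat.succ_le_succ hrN))]
    · refine Finset.sum_congr rfl fun j hj => ?_
      rw [Finset.mem_range] at hj
      rw [Matrix.mul_smul, ← pow_add]
      congr 2
      omega
    · intro j hj hj'
      rw [Finset.mem_range] at hj hj'
      have hej : e j = 0 := by
        by_contra hne
        have := hmax (show j ∈ {j : ℕ | j ≤ N ∧ e j ≠ 0} from ⟨by omega, hne⟩)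
        omega
      simp [hej]
  rcases hk : N - r with _ | k
  · rw [hk, pow_zero, Matrix.one_mul] at hfac
    rw [hfac, Matrix.mul_zero]
  · rw [hk] at hfac
    exact transpose_mul_eq_zero_of_mul_transpose_pow_mul_eq_zero M _ k hfac

/-- **Decell's formula.** Let `M` be a real `N × m` matrix, let `e_0, …, e_N` be defined
by `det(λ I_N − M Mᵀ) = ∑_{j=0}^N (−1)^j e_j λ^{N−j}` (so `e_0 = 1`), let
`r := max { j ∈ {0,…,N} : e_j ≠ 0 }`, and let `M†` be the Moore–Penrose pseudoinverse of
`M`. Then: if `r = 0` then `M† = 0`; and if `r ≥ 1` then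
`M† = e_r⁻¹ Mᵀ ∑_{j=0}^{r−1} (−1)^{r−1−j} e_j (M Mᵀ)^{r−1−j}`. -/
theorem decell_formula
    {N m : ℕ} (M : Matrix (Fin N) (Fin m) ℝ)
    (e : ℕ → ℝ)
    (he : ∀ lam : ℝ,
      (lam • (1 : Matrix (Fin N) (Fin N) ℝ) - M * Mᵀ).det
        = ∑ j ∈ Finset.range (N + 1), (-1 : ℝ) ^ j * e j * lam ^ (N - j))
    (r : ℕ) (hr : IsGreatest {j : ℕ | j ≤ N ∧ e j ≠ 0} r)
    (Mdag : Matrix (Fin m) (Fin N) ℝ)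
    (h1 : M * Mdag * M = M) (h2 : Mdag * M * Mdag = Mdag)
    (h3 : (M * Mdag)ᵀ = M * Mdag) (h4 : (Mdag * M)ᵀ = Mdag * M) :
    (r = 0 → Mdag = 0) ∧
    (1 ≤ r → Mdag = (e r)⁻¹ •
      (Mᵀ * ∑ j ∈ Finset.range r, ((-1 : ℝ) ^ (r - 1 - j) * e j) • (M * Mᵀ) ^ (r - 1 - j))) := by
  have hq := transpose_mul_sum_eq_zero M e he r hr
  have her : e r ≠ 0 := hr.1.2
  have hdag : Mᵀ * (Mdagᵀ * Mdag) = Mdag := by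
    rw [← Matrix.mul_assoc, ← transpose_mul, h4, h2]
  refine ⟨?_, ?_⟩
  · rintro rfl
    have hM : Mᵀ = 0 := by simpa [her] using hq
    rw [← hdag, hM, Matrix.zero_mul]
  · intro hr1
    set S := ∑ j ∈ Finset.range r,
      ((-1 : ℝ) ^ (r - 1 - j) * e j) • (M * Mᵀ) ^ (r - 1 - j) with hS
    have hproj : Mᵀ * (M * Mdag) = Mᵀ := by
      rw [← h3, ← transpose_mul, h1]
    have hpow : ∀ k : ℕ, Mᵀ * (M * Mᵀ) ^ k * (M * Mdag) = Mᵀ * (M * Mᵀ) ^ k := by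
      intro k
      cases k with
      | zero => simpa using hproj
      | succ k => rw [pow_succ]; simp only [Matrix.mul_assoc, hproj]
    have hSproj : Mᵀ * S * (M * Mdag) = Mᵀ * S := by
      simp only [hS, Matrix.mul_sum, Matrix.sum_mul, Matrix.mul_smul, Matrix.smul_mul, hpow]
    have hsum : ∑ j ∈ Finset.range r, ((-1 : ℝ) ^ j * e j) • (M * Mᵀ) ^ (r - j)
        = (-1 : ℝ) ^ (r - 1) • (S * (M * Mᵀ)) := by
      rw [hS, Matrix.sum_mul, Finset.smul_sum]
      refine Finset.sum_congr rfl fun j hj => ?_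
      rw [Finset.mem_range] at hj
      obtain ⟨k, rfl⟩ : ∃ k, r = j + k + 1 := ⟨r - 1 - j, by omega⟩
      have e1 : j + k + 1 - 1 - j = k := by omega
      have e2 : j + k + 1 - j = k + 1 := by omega
      have hsign : (-1 : ℝ) ^ k * (-1) ^ k = 1 := by
        rw [← mul_pow]; norm_num
      rw [e1, e2, Matrix.smul_mul, ← pow_succ, smul_smul, Nat.add_sub_cancel, pow_add]
      congr 1
      linear_combination (-(-1 : ℝ) ^ j * e j) * hsign
    have hrec : e r • Mᵀ = Mᵀ * S * (M * Mᵀ) := by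
      rw [Finset.sum_range_succ, hsum, Nat.sub_self, pow_zero, Matrix.mul_add,
        Matrix.mul_smul, Matrix.mul_smul, Matrix.mul_one, ← Matrix.mul_assoc] at hq
      obtain ⟨k, rfl⟩ : ∃ k, r = k + 1 := ⟨r - 1, by omega⟩
      have hsign : ((-1 : ℝ) ^ k) ≠ 0 := pow_ne_zero _ (by norm_num)
      rw [Nat.add_sub_cancel, pow_succ, mul_assoc, mul_smul, ← smul_add,
        smul_eq_zero_iff_right hsign, neg_one_mul, neg_smul, ← sub_eq_add_neg,
        sub_eq_zero] at hq
      exact hq.symm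
    rw [eq_inv_smul_iff₀ her]
    calc e r • Mdag = (e r • Mᵀ) * (Mdagᵀ * Mdag) := by rw [Matrix.smul_mul, hdag]
      _ = Mᵀ * S * (M * (Mᵀ * (Mdagᵀ * Mdag))) := by
        rw [hrec]; simp only [Matrix.mul_assoc]
      _ = Mᵀ * S := by rw [hdag, hSproj]
end

section
/- Let A(ξ) = Σ_{|α|=k} ξ^α A_α be a k-homogeneous symbol on ℝ^n with values in Lin(W,X) having constant rank on ℝ^n \ {0}. Then the map ξ ↦ A†(ξ), assigning to each ξ the Moore–Penrose pseudoinverse of A(ξ), is infinitely differentiable (C^∞) on ℝ^n \ {0}; consequently the projection map ξ ↦ Id_W − A†(ξ)A(ξ) is also C^∞ on ℝ^n \ {0}. -/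
open scoped BigOperators

open scoped Topology
open Filter

/-- If `E` is an operator on a finite-dimensional real inner product space, then `1 + E - E*` is
invertible, since `E - E*` is skew-adjoint. -/
theorem isUnit_one_add_sub_star {V : Type*} [NormedAddCommGroup V] [InnerProductSpace ℝ V]
    [FiniteDimensional ℝ V] [CompleteSpace V] (E : V →L[ℝ] V) : IsUnit (1 + E - star E) := by
  rw [ContinuousLinearMap.isUnit_iff_isUnit_toLinearMap, LinearMap.isUnit_iff_ker_eq_bot,
    LinearMap.ker_eq_bot']
  intro x hx
  have hx' : x + E x - (star E) x = 0 := hx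
  have h := congrArg (fun y => inner ℝ y x) hx'
  simp only [inner_sub_left, inner_add_left, ContinuousLinearMap.star_eq_adjoint,
    ContinuousLinearMap.adjoint_inner_left, inner_zero_left, real_inner_comm x (E x)] at h
  exact inner_self_eq_zero.mp (by linarith : inner ℝ x x = (0 : ℝ))

/-- A family of orthogonal projections `P` is as smooth as any family `E` of (possibly oblique)
projections with the same ranges. -/
theorem contDiffAt_of_isSelfAdjoint_of_mul_eq {F V : Type*} [NormedAddCommGroup F]
    [NormedSpace ℝ F] [NormedAddCommGroup V] [InnerProductSpace ℝ V] [FiniteDimensional ℝ V]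
    [CompleteSpace V] {m : WithTop ℕ∞} {E P : F → V →L[ℝ] V} {x₀ : F} (hE : ContDiffAt ℝ m E x₀)
    (hP : ∀ᶠ x in 𝓝 x₀, IsSelfAdjoint (P x)) (hPE : ∀ᶠ x in 𝓝 x₀, P x * E x = E x)
    (hEP : ∀ᶠ x in 𝓝 x₀, E x * P x = P x) : ContDiffAt ℝ m P x₀ := by
  have hstar : ContDiffAt ℝ m (fun x => star (E x)) x₀ :=
    (starL' ℝ : (V →L[ℝ] V) ≃L[ℝ] (V →L[ℝ] V)).contDiff.contDiffAt.comp x₀ hE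
  have hinv : ContDiffAt ℝ m (fun x => Ring.inverse (1 + E x - star (E x))) x₀ := by
    obtain ⟨u, hu⟩ := isUnit_one_add_sub_star (E x₀)
    refine ContDiffAt.comp x₀ (g := Ring.inverse) (f := fun x => 1 + E x - star (E x)) ?_
      ((contDiffAt_const.add hE).sub hstar)
    rw [← hu]
    exact contDiffAt_ringInverse ℝ u
  refine (hE.mul hinv).congr_of_eventuallyEq ?_
  filter_upwards [hP, hPE, hEP] with x h₁ h₂ h₃
  have h₄ : P x * star (E x) = P x := by
    simpa [h₁.star_eq] using congrArg star h₃
  have h₅ : P x * (1 + E x - star (E x)) = E x := by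
    rw [mul_sub, mul_add, h₂, h₄, mul_one, add_sub_cancel_left]
  calc P x = P x * (1 + E x - star (E x)) * Ring.inverse (1 + E x - star (E x)) :=
        (Ring.mul_inverse_cancel_right _ _ (isUnit_one_add_sub_star _)).symm
    _ = E x * Ring.inverse (1 + E x - star (E x)) := by rw [h₅]

/-- Perturbation of generalized inverses: if `S` has the same rank as `T`, `G` is a generalized
inverse of `T`, and `U = 1 + (S - T) G` is invertible, then `G U⁻¹` is a generalized inverse
of `S`. -/
theorem comp_ringInverse_comp_eq_of_finrank_range_eq {W X : Type*}
    [NormedAddCommGroup W] [NormedSpace ℝ W]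
    [NormedAddCommGroup X] [NormedSpace ℝ X] [FiniteDimensional ℝ X]
    {S T : W →L[ℝ] X} {G : X →L[ℝ] W} (hG : ∀ w, T (G (T w)) = T w)
    (hrank : Module.finrank ℝ S.range = Module.finrank ℝ T.range)
    (hU : IsUnit (1 + (S - T) ∘L G)) (w : W) :
    S (G (Ring.inverse (1 + (S - T) ∘L G) (S w))) = S w := by
  set U : X →L[ℝ] X := 1 + (S - T) ∘L G with hUdef
  have hleft : ∀ x, Ring.inverse U (U x) = x := fun x =>
    DFunLike.congr_fun (Ring.inverse_mul_cancel U hU) x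
  have hUT : ∀ v, U (T v) = S (G (T v)) := by
    intro v
    simp [hUdef, hG]
  have hinj : Function.Injective (U : X →ₗ[ℝ] X) := Function.LeftInverse.injective hleft
  have hmap : T.range.map (U : X →ₗ[ℝ] X) = S.range := by
    refine Submodule.eq_of_le_of_finrank_eq ?_ ?_
    · rintro _ ⟨_, ⟨v, rfl⟩, rfl⟩
      exact ⟨G (T v), (hUT v).symm⟩
    · rw [hrank]
      exact (Submodule.equivMapOfInjective _ hinj _).finrank_eq.symm
  have hw : S w ∈ T.range.map (U : X →ₗ[ℝ] X) := hmap ▸ ⟨w, rfl⟩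
  obtain ⟨_, ⟨v, rfl⟩, hv⟩ := hw
  have hv' : U (T v) = S w := hv
  rw [← hv', hleft, ← hUT]

/-- The Moore–Penrose pseudoinverse of a smooth family of linear maps of locally constant rank is
smooth. -/
theorem contDiffAt_pseudoinverse {F W X : Type*} [NormedAddCommGroup F] [NormedSpace ℝ F]
    [NormedAddCommGroup W] [InnerProductSpace ℝ W] [FiniteDimensional ℝ W] [CompleteSpace W]
    [NormedAddCommGroup X] [InnerProductSpace ℝ X] [FiniteDimensional ℝ X] [CompleteSpace X]
    {m : WithTop ℕ∞} {A : F → W →L[ℝ] X} {B : F → X →L[ℝ] W} {x₀ : F}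
    (hA : ContDiffAt ℝ m A x₀)
    (hrank : ∀ᶠ x in 𝓝 x₀, Module.finrank ℝ (A x).range = Module.finrank ℝ (A x₀).range)
    (hABA : ∀ x w, A x (B x (A x w)) = A x w) (hBAB : ∀ x y, B x (A x (B x y)) = B x y)
    (hAB : ∀ x, IsSelfAdjoint (A x ∘L B x)) (hBA : ∀ x, IsSelfAdjoint (B x ∘L A x)) :
    ContDiffAt ℝ m B x₀ := by
  set U : F → X →L[ℝ] X := fun x => 1 + (A x - A x₀) ∘L B x₀ with hUdef
  have hU : ContDiffAt ℝ m U x₀ :=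
    contDiffAt_const.add ((hA.sub contDiffAt_const).clm_comp contDiffAt_const)
  have hU₀ : U x₀ = 1 := by simp [hUdef]
  have hUnit : ∀ᶠ x in 𝓝 x₀, IsUnit (U x) :=
    hU.continuousAt.eventually (by rw [hU₀]; exact Units.isOpen.mem_nhds isUnit_one)
  have hUinv : ContDiffAt ℝ m (fun x => Ring.inverse (U x)) x₀ := by
    refine ContDiffAt.comp x₀ (g := Ring.inverse) ?_ hU
    rw [hU₀]
    exact contDiffAt_ringInverse ℝ 1
  set G : F → X →L[ℝ] W := fun x => B x₀ ∘L Ring.inverse (U x) with hGdef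
  have hG : ContDiffAt ℝ m G x₀ := contDiffAt_const.clm_comp hUinv
  have hAGA : ∀ᶠ x in 𝓝 x₀, ∀ w, A x (G x (A x w)) = A x w := by
    filter_upwards [hrank, hUnit] with x h₁ h₂ w
    exact comp_ringInverse_comp_eq_of_finrank_range_eq (hABA x₀) h₁ h₂ w
  have hP : ContDiffAt ℝ m (fun x => A x ∘L B x) x₀ := by
    refine contDiffAt_of_isSelfAdjoint_of_mul_eq (hA.clm_comp hG) (.of_forall hAB)
      (.of_forall fun x => ?_) ?_
    · ext y
      simp [hABA]
    · filter_upwards [hAGA] with x hx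
      ext y
      simp [hx]
  have hQ : ContDiffAt ℝ m (fun x => B x ∘L A x) x₀ := by
    have hstar : ContDiffAt ℝ m (fun x => star (G x ∘L A x)) x₀ :=
      (starL' ℝ : (W →L[ℝ] W) ≃L[ℝ] (W →L[ℝ] W)).contDiff.contDiffAt.comp x₀ (hG.clm_comp hA)
    refine contDiffAt_of_isSelfAdjoint_of_mul_eq hstar (.of_forall hBA)
      (.of_forall fun x => ?_) ?_
    · have h : (G x ∘L A x) * (B x ∘L A x) = G x ∘L A x := by
        ext w
        simp [hABA]
      simpa only [star_mul, (hBA x).star_eq] using congrArg star h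
    · filter_upwards [hAGA] with x hx
      have h : (B x ∘L A x) * (G x ∘L A x) = B x ∘L A x := by
        ext w
        simp [hx]
      simpa only [star_mul, (hBA x).star_eq] using congrArg star h
  refine (hQ.clm_comp (hG.clm_comp hP)).congr_of_eventuallyEq ?_
  filter_upwards [hAGA] with x hx
  ext y
  simp [hx, hBAB]

/-- The symbol of a differential operator depends smoothly on the frequency. -/
theorem contDiff_symbolOf {n : ℕ} {W X : Type*}
    [NormedAddCommGroup W] [NormedSpace ℝ W] [FiniteDimensional ℝ W]
    [NormedAddCommGroup X] [NormedSpace ℝ X] {m : WithTop ℕ∞}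
    (k : ℕ) (coef : (Fin n → ℕ) → (W →ₗ[ℝ] X)) :
    ContDiff ℝ m (fun ξ => LinearMap.toContinuousLinearMap (symbolOf k coef ξ)) := by
  simp only [symbolOf, map_sum, map_smul]
  refine ContDiff.sum fun α _ => ?_
  have h : ContDiff ℝ m fun ξ : Fin n → ℝ => ∏ i, ξ i ^ α i :=
    contDiff_prod fun i _ => (contDiff_apply ℝ ℝ i).pow _
  exact h.smul contDiff_const

/-- Let `A(ξ)` be a `k`-homogeneous symbol on `ℝ^n` with values in `Lin(W, X)` of
constant rank on `ℝ^n \ {0}`, and let `A†(ξ)` denote the Moore–Penrose pseudoinverse of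
`A(ξ)`. Then `ξ ↦ A†(ξ)` is `C^∞` on `ℝ^n \ {0}`; consequently the projection map
`ξ ↦ Id_W − A†(ξ) A(ξ)` is also `C^∞` on `ℝ^n \ {0}`. -/
theorem pseudoinverse_of_constant_rank_symbol_smooth
    {n k : ℕ} (hn : 1 ≤ n) (hk : 1 ≤ k)
    {W X : Type*}
    [NormedAddCommGroup W] [InnerProductSpace ℝ W] [FiniteDimensional ℝ W]
    [NormedAddCommGroup X] [InnerProductSpace ℝ X] [FiniteDimensional ℝ X]
    (Acoef : (Fin n → ℕ) → (W →ₗ[ℝ] X))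
    (A : (Fin n → ℝ) → (W →ₗ[ℝ] X)) (hA : ∀ ξ, A ξ = symbolOf k Acoef ξ)
    (r : ℕ)
    (hrank : ∀ ξ : Fin n → ℝ, ξ ≠ 0 → Module.finrank ℝ (LinearMap.range (A ξ)) = r)
    (Adag : (Fin n → ℝ) → (X →ₗ[ℝ] W))
    (hdag : ∀ ξ : Fin n → ℝ,
      (A ξ) ∘ₗ (Adag ξ) ∘ₗ (A ξ) = A ξ ∧
      (Adag ξ) ∘ₗ (A ξ) ∘ₗ (Adag ξ) = Adag ξ ∧
      LinearMap.adjoint ((A ξ) ∘ₗ (Adag ξ)) = (A ξ) ∘ₗ (Adag ξ) ∧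
      LinearMap.adjoint ((Adag ξ) ∘ₗ (A ξ)) = (Adag ξ) ∘ₗ (A ξ)) :
    ContDiffOn ℝ (⊤ : ℕ∞) (fun ξ : Fin n → ℝ =>
        (LinearMap.toContinuousLinearMap (Adag ξ) : X →L[ℝ] W)) {ξ : Fin n → ℝ | ξ ≠ 0} ∧
    ContDiffOn ℝ (⊤ : ℕ∞) (fun ξ : Fin n → ℝ =>
        (LinearMap.toContinuousLinearMap
          ((LinearMap.id : W →ₗ[ℝ] W) - (Adag ξ) ∘ₗ (A ξ)) : W →L[ℝ] W))
      {ξ : Fin n → ℝ | ξ ≠ 0} := by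
  have : CompleteSpace W := FiniteDimensional.complete ℝ W
  have : CompleteSpace X := FiniteDimensional.complete ℝ X
  have hsmooth : ContDiff ℝ (⊤ : ℕ∞) (fun ξ => LinearMap.toContinuousLinearMap (A ξ)) := by
    simpa only [hA] using contDiff_symbolOf k Acoef
  have hdag_smooth : ContDiffOn ℝ (⊤ : ℕ∞) (fun ξ : Fin n → ℝ =>
      (LinearMap.toContinuousLinearMap (Adag ξ) : X →L[ℝ] W)) {ξ : Fin n → ℝ | ξ ≠ 0} := by
    intro ξ₀ hξ₀
    refine (contDiffAt_pseudoinverse hsmooth.contDiffAt ?_ (fun ξ w => ?_) (fun ξ y => ?_)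
      (fun ξ => ?_) (fun ξ => ?_)).contDiffWithinAt
    · filter_upwards [isOpen_ne.mem_nhds hξ₀] with ξ hξ
      exact (hrank ξ hξ).trans (hrank ξ₀ hξ₀).symm
    · exact LinearMap.congr_fun (hdag ξ).1 w
    · exact LinearMap.congr_fun (hdag ξ).2.1 y
    · exact (LinearMap.isSelfAdjoint_toContinuousLinearMap_iff (A ξ ∘ₗ Adag ξ)).mpr
        (hdag ξ).2.2.1
    · exact (LinearMap.isSelfAdjoint_toContinuousLinearMap_iff (Adag ξ ∘ₗ A ξ)).mpr
        (hdag ξ).2.2.2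
  have hid : ContDiffOn ℝ (⊤ : ℕ∞) (fun _ : Fin n → ℝ => ContinuousLinearMap.id ℝ W)
    {ξ : Fin n → ℝ | ξ ≠ 0} := contDiffOn_const
  exact ⟨hdag_smooth, (hid.sub (hdag_smooth.clm_comp hsmooth.contDiffOn)).congr fun _ _ => rfl⟩
end
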